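/- arXiv:2511.07058 — 12 statements merged into one kernel-verified Lean document; each statement's English description precedes it below -/
import Mathlib

section
/- Let A be an abelian group and φ, ψ two endogenies of A. Then the sum φ + ψ := {(a,b) ∈ A × A : ∃ b₁ b₂, (a,b₁) ∈ φ, (a,b₂) ∈ ψ, b = b₁ + b₂} is again an endogeny of A, and its katakernel equals kat(φ) + kat(ψ). -/
open Pointwise

variable {A : Type*} [AddCommGroup A]

/-- `φ` is (the underlying set of) an additive subgroup of `A × A`. -/
def IsSubgroupRel (φ : Set (A × A)) : Prop :=
  (0 : A × A) ∈ φ ∧ (∀ x ∈ φ, ∀ y ∈ φ, x + y ∈ φ) ∧ ∀ x ∈ φ, -x ∈ φ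

/-- The katakernel `kat φ = {b : (0, b) ∈ φ}`. -/
def kat (φ : Set (A × A)) : Set A := {b | ((0 : A), b) ∈ φ}

/-- The image `φ[S] = {b : ∃ a ∈ S, (a, b) ∈ φ}`. -/
def img (φ : Set (A × A)) (S : Set A) : Set A := {b | ∃ a ∈ S, (a, b) ∈ φ}

/-- An endogeny of `A`: a total additive subgroup of `A × A` with finite katakernel. -/
def IsEndogeny (φ : Set (A × A)) : Prop :=
  IsSubgroupRel φ ∧ (∀ a : A, ∃ b, (a, b) ∈ φ) ∧ (kat φ).Finite

/-- The sum `φ + ψ` of two endogenies. -/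
def esum (φ ψ : Set (A × A)) : Set (A × A) :=
  {p | ∃ b₁ b₂, (p.1, b₁) ∈ φ ∧ (p.1, b₂) ∈ ψ ∧ p.2 = b₁ + b₂}

/-- The composition `φ ∘ ψ` of two endogenies. -/
def ecomp (φ ψ : Set (A × A)) : Set (A × A) :=
  {p | ∃ b, (p.1, b) ∈ ψ ∧ (b, p.2) ∈ φ}

/-- The negation `-φ` of an endogeny. -/
def eneg (φ : Set (A × A)) : Set (A × A) := {p | (p.1, -p.2) ∈ φ}

/-- The katakernel of a sum of relations is the sum of their katakernels. -/
theorem kat_esum (φ ψ : Set (A × A)) : kat (esum φ ψ) = kat φ + kat ψ := by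
  ext b
  constructor
  · rintro ⟨b₁, b₂, h₁, h₂, h⟩
    exact Set.mem_add.2 ⟨b₁, h₁, b₂, h₂, h.symm⟩
  · intro hb
    obtain ⟨b₁, h₁, b₂, h₂, h⟩ := Set.mem_add.1 hb
    exact ⟨b₁, b₂, h₁, h₂, h.symm⟩

/-- The sum of two additive relations is additive. -/
theorem IsSubgroupRel.esum {φ ψ : Set (A × A)} (hφ : IsSubgroupRel φ) (hψ : IsSubgroupRel ψ) :
    IsSubgroupRel (esum φ ψ) := by
  obtain ⟨zeroφ, addφ, negφ⟩ := hφ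
  obtain ⟨zeroψ, addψ, negψ⟩ := hψ
  refine ⟨⟨0, 0, zeroφ, zeroψ, (add_zero 0).symm⟩, ?_, ?_⟩
  · rintro ⟨a, _⟩ ⟨b₁, b₂, h₁, h₂, rfl⟩ ⟨c, _⟩ ⟨d₁, d₂, k₁, k₂, rfl⟩
    exact ⟨b₁ + d₁, b₂ + d₂, addφ _ h₁ _ k₁, addψ _ h₂ _ k₂, add_add_add_comm b₁ b₂ d₁ d₂⟩
  · rintro ⟨a, _⟩ ⟨b₁, b₂, h₁, h₂, rfl⟩
    exact ⟨-b₁, -b₂, negφ _ h₁, negψ _ h₂, neg_add b₁ b₂⟩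

theorem sum_isEndogeny (φ ψ : Set (A × A)) (hφ : IsEndogeny φ) (hψ : IsEndogeny ψ) :
    IsEndogeny (esum φ ψ) ∧ kat (esum φ ψ) = kat φ + kat ψ := by
  obtain ⟨subφ, totφ, finφ⟩ := hφ
  obtain ⟨subψ, totψ, finψ⟩ := hψ
  refine ⟨⟨subφ.esum subψ, fun a => ?_, ?_⟩, kat_esum φ ψ⟩
  · obtain ⟨b₁, h₁⟩ := totφ a
    obtain ⟨b₂, h₂⟩ := totψ a
    exact ⟨b₁ + b₂, b₁, b₂, h₁, h₂, rfl⟩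
  · rw [kat_esum]
    exact finφ.add finψ
end

section
/- Let A be an abelian group and φ, ψ two endogenies of A. Then the composition φ ∘ ψ := {(a,c) ∈ A × A : ∃ b, (a,b) ∈ ψ, (b,c) ∈ φ} is again an endogeny of A, and its katakernel equals φ[kat(ψ)]. -/
open Pointwise

variable {A : Type*} [AddCommGroup A]

theorem isSubgroupRel_ecomp {φ ψ : Set (A × A)} (hφ : IsSubgroupRel φ) (hψ : IsSubgroupRel ψ) :
    IsSubgroupRel (ecomp φ ψ) := by
  obtain ⟨hφ0, hφadd, hφneg⟩ := hφ
  obtain ⟨hψ0, hψadd, hψneg⟩ := hψ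
  refine ⟨⟨0, hψ0, hφ0⟩, ?_, ?_⟩
  · rintro x ⟨b, hb, hb'⟩ y ⟨c, hc, hc'⟩
    exact ⟨b + c, hψadd _ hb _ hc, hφadd _ hb' _ hc'⟩
  · rintro x ⟨b, hb, hb'⟩
    exact ⟨-b, hψneg _ hb, hφneg _ hb'⟩

theorem kat_ecomp (φ ψ : Set (A × A)) : kat (ecomp φ ψ) = img φ (kat ψ) := rfl

/-- Each fibre of an endogeny is a translate of its katakernel, hence finite. -/
theorem IsEndogeny.finite_fiber {φ : Set (A × A)} (hφ : IsEndogeny φ) (a : A) :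
    {b | (a, b) ∈ φ}.Finite := by
  obtain ⟨⟨-, hadd, hneg⟩, htot, hfin⟩ := hφ
  obtain ⟨b₀, hb₀⟩ := htot a
  refine (hfin.image (· + b₀)).subset fun b hb => ⟨b - b₀, ?_, sub_add_cancel b b₀⟩
  simpa [kat, sub_eq_add_neg] using hadd _ hb _ (hneg _ hb₀)

theorem IsEndogeny.finite_img {φ : Set (A × A)} (hφ : IsEndogeny φ) {S : Set A}
    (hS : S.Finite) : (img φ S).Finite := by
  refine (hS.biUnion fun a _ => hφ.finite_fiber a).subset ?_
  rintro b ⟨a, ha, hb⟩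
  exact Set.mem_biUnion ha hb

theorem comp_isEndogeny (φ ψ : Set (A × A)) (hφ : IsEndogeny φ) (hψ : IsEndogeny ψ) :
    IsEndogeny (ecomp φ ψ) ∧ kat (ecomp φ ψ) = img φ (kat ψ) := by
  refine ⟨⟨isSubgroupRel_ecomp hφ.1 hψ.1, fun a => ?_, ?_⟩, kat_ecomp φ ψ⟩
  · obtain ⟨b, hb⟩ := hψ.2.1 a
    obtain ⟨c, hc⟩ := hφ.2.1 b
    exact ⟨c, b, hb, hc⟩
  · rw [kat_ecomp]
    exact hφ.finite_img hψ.2.2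
end

section
/- Left distributivity holds for endogenies: if δ, φ, ψ are endogenies of an abelian group A, then for every a ∈ A one has (δ ∘ (φ + ψ))[a] = (δ ∘ φ)[a] + (δ ∘ ψ)[a] (as subsets of A). -/
open Pointwise

variable {A : Type*} [AddCommGroup A]

theorem left_distrib_endogeny (δ φ ψ : Set (A × A))
    (hδ : IsEndogeny δ) (hφ : IsEndogeny φ) (hψ : IsEndogeny ψ) (a : A) :
    img (ecomp δ (esum φ ψ)) {a} = img (ecomp δ φ) {a} + img (ecomp δ ψ) {a} := by
  obtain ⟨⟨-, hadd, hneg⟩, htotal, -⟩ := hδ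
  ext c
  simp only [img, ecomp, esum, Set.mem_add, Set.mem_ofPred_eq, Set.mem_singleton_iff,
    exists_eq_left]
  constructor
  · rintro ⟨_, ⟨b₁, b₂, h₁, h₂, rfl⟩, hc⟩
    obtain ⟨c₁, hc₁⟩ := htotal b₁
    have hc₂ := hadd _ hc _ (hneg _ hc₁)
    simp only [Prod.neg_mk, Prod.mk_add_mk, add_neg_cancel_comm] at hc₂
    exact ⟨c₁, ⟨b₁, h₁, hc₁⟩, c + -c₁, ⟨b₂, h₂, hc₂⟩, by abel⟩
  · rintro ⟨c₁, ⟨b₁, h₁, hc₁⟩, c₂, ⟨b₂, h₂, hc₂⟩, rfl⟩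
    exact ⟨b₁ + b₂, ⟨b₁, b₂, h₁, h₂, rfl⟩, hadd _ hc₁ _ hc₂⟩
end

section
/- Right distributivity for endogenies holds up to a finite error set: if δ, φ, ψ are endogenies of an abelian group A, then for every a ∈ A one has (φ ∘ δ + ψ ∘ δ)[a] ⊆ ((φ + ψ) ∘ δ)[a] + φ[kat(δ)]. -/
open Pointwise

variable {A : Type*} [AddCommGroup A]

theorem right_distrib_endogeny (δ φ ψ : Set (A × A))
    (hδ : IsEndogeny δ) (hφ : IsEndogeny φ) (hψ : IsEndogeny ψ) (a : A) :
    img (esum (ecomp φ δ) (ecomp ψ δ)) {a} ⊆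
      img (ecomp (esum φ ψ) δ) {a} + img φ (kat δ) := by
  rintro x ⟨_, rfl, b₁, b₂, ⟨c₁, hc₁, hb₁⟩, ⟨c₂, hc₂, hb₂⟩, rfl⟩
  obtain ⟨d, hd⟩ := hφ.2.1 c₂
  refine ⟨d + b₂, ⟨_, rfl, c₂, hc₂, d, b₂, hd, hb₂, rfl⟩, b₁ - d, ⟨c₁ - c₂, ?_, ?_⟩, ?_⟩
  · simpa [kat, sub_eq_add_neg] using hδ.1.2.1 _ hc₁ _ (hδ.1.2.2 _ hc₂)
  · simpa [sub_eq_add_neg] using hφ.1.2.1 _ hb₁ _ (hφ.1.2.2 _ hd)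
  · change d + b₂ + (b₁ - d) = b₁ + b₂
    abel
end

section
/- The relation ∼ on the set of endogenies of an abelian group A, defined by φ ∼ ψ if and only if (φ + (−ψ))[A] is finite, is an equivalence relation; in particular it is transitive: if (φ + (−ψ))[A] and (ψ + (−δ))[A] are finite, then (φ + (−δ))[A] is finite. -/
open Pointwise

variable {A : Type*} [AddCommGroup A]

/-- `φ ∼ ψ` iff `(φ + (-ψ))[A]` is finite. -/
def eequiv (φ ψ : Set (A × A)) : Prop := (img (esum φ (eneg ψ)) Set.univ).Finite

theorem mem_img_esum_eneg_univ {φ ψ : Set (A × A)} {b : A} :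
    b ∈ img (esum φ (eneg ψ)) Set.univ ↔ ∃ a c d, (a, c) ∈ φ ∧ (a, d) ∈ ψ ∧ b = c - d := by
  constructor
  · rintro ⟨a, -, c, d, hc, hd, rfl⟩
    exact ⟨a, c, -d, hc, hd, by simp⟩
  · rintro ⟨a, c, d, hc, hd, rfl⟩
    exact ⟨a, trivial, c, -d, hc, by simpa [eneg] using hd, by simp [sub_eq_add_neg]⟩

theorem IsSubgroupRel.sub_mem {φ : Set (A × A)} (h : IsSubgroupRel φ) {x y : A × A}
    (hx : x ∈ φ) (hy : y ∈ φ) : x - y ∈ φ := by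
  rw [sub_eq_add_neg]
  exact h.2.1 _ hx _ (h.2.2 _ hy)

theorem IsEndogeny.eequiv_refl {φ : Set (A × A)} (h : IsEndogeny φ) : eequiv φ φ := by
  refine h.2.2.subset fun b hb => ?_
  obtain ⟨a, c, d, hc, hd, rfl⟩ := mem_img_esum_eneg_univ.1 hb
  simpa [kat] using h.1.sub_mem hc hd

theorem eequiv.symm {φ ψ : Set (A × A)} (h : eequiv φ ψ) : eequiv ψ φ := by
  refine (Set.Finite.neg h).subset fun b hb => ?_
  obtain ⟨a, c, d, hc, hd, rfl⟩ := mem_img_esum_eneg_univ.1 hb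
  exact Set.mem_neg.2 (mem_img_esum_eneg_univ.2 ⟨a, d, c, hd, hc, neg_sub c d⟩)

theorem eequiv.trans {φ ψ δ : Set (A × A)} (htotal : ∀ a, ∃ b, (a, b) ∈ ψ)
    (h₁ : eequiv φ ψ) (h₂ : eequiv ψ δ) : eequiv φ δ := by
  refine (Set.Finite.add h₁ h₂).subset fun b hb => ?_
  obtain ⟨a, c, d, hc, hd, rfl⟩ := mem_img_esum_eneg_univ.1 hb
  obtain ⟨e, he⟩ := htotal a
  exact Set.mem_add.2 ⟨c - e, mem_img_esum_eneg_univ.2 ⟨a, c, e, hc, he, rfl⟩,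
    e - d, mem_img_esum_eneg_univ.2 ⟨a, e, d, he, hd, rfl⟩, sub_add_sub_cancel c e d⟩

theorem eequiv_is_equivalence (A : Type*) [AddCommGroup A] :
    (∀ φ : Set (A × A), IsEndogeny φ → eequiv φ φ) ∧
    (∀ φ ψ : Set (A × A), IsEndogeny φ → IsEndogeny ψ → eequiv φ ψ → eequiv ψ φ) ∧
    (∀ φ ψ δ : Set (A × A), IsEndogeny φ → IsEndogeny ψ → IsEndogeny δ →
      eequiv φ ψ → eequiv ψ δ → eequiv φ δ) := by
  exact ⟨fun _ h => h.eequiv_refl, fun _ _ _ _ h => h.symm,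
    fun _ _ _ _ hψ _ h₁ h₂ => h₁.trans hψ.2.1 h₂⟩
end

section
/- The sharp centralizer is closed under the pre-ring operations: if φ and ψ are endogenies of an abelian group A that each sharply commute with an endogeny χ, then φ + ψ, −φ, and φ ∘ ψ all sharply commute with χ. -/
open Pointwise

variable {A : Type*} [AddCommGroup A]

/-- `φ` and `ψ` sharply commute if `(φ ∘ ψ - ψ ∘ φ)[A] ⊆ kat φ + kat ψ`. -/
def SharpCommute (φ ψ : Set (A × A)) : Prop :=
  img (esum (ecomp φ ψ) (eneg (ecomp ψ φ))) Set.univ ⊆ kat φ + kat ψ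

theorem IsSubgroupRel.add_mem {φ : Set (A × A)} (h : IsSubgroupRel φ) {a b c d : A}
    (hab : (a, b) ∈ φ) (hcd : (c, d) ∈ φ) : (a + c, b + d) ∈ φ :=
  h.2.1 _ hab _ hcd

theorem IsSubgroupRel.neg_mem {φ : Set (A × A)} (h : IsSubgroupRel φ) {a b : A}
    (hab : (a, b) ∈ φ) : (-a, -b) ∈ φ :=
  h.2.2 _ hab

theorem IsSubgroupRel.sub_mem_s7 {φ : Set (A × A)} (h : IsSubgroupRel φ) {a b c d : A}
    (hab : (a, b) ∈ φ) (hcd : (c, d) ∈ φ) : (a - c, b - d) ∈ φ := by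
  simpa only [sub_eq_add_neg] using h.add_mem hab (h.neg_mem hcd)

/-- Sharp commutation, stated elementwise. -/
theorem sharpCommute_iff {φ ψ : Set (A × A)} :
    SharpCommute φ ψ ↔ ∀ a b x c y, (a, b) ∈ ψ → (b, x) ∈ φ → (a, c) ∈ φ → (c, y) ∈ ψ →
      ∃ k l, ((0 : A), k) ∈ φ ∧ ((0 : A), l) ∈ ψ ∧ k + l = x - y := by
  constructor
  · intro h a b x c y hab hbx hac hcy
    have hmem : x - y ∈ img (esum (ecomp φ ψ) (eneg (ecomp ψ φ))) Set.univ :=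
      ⟨a, trivial, x, -y, ⟨b, hab, hbx⟩, ⟨c, hac, by simpa using hcy⟩, sub_eq_add_neg x y⟩
    obtain ⟨k, hk, l, hl, e⟩ := h hmem
    exact ⟨k, l, hk, hl, e⟩
  · rintro h z ⟨a, -, x, y, ⟨b, hab, hbx⟩, ⟨c, hac, hcy⟩, hz⟩
    obtain ⟨k, l, hk, hl, e⟩ := h a b x c (-y) hab hbx hac hcy
    refine ⟨k, hk, l, hl, ?_⟩
    simpa [e] using hz.symm

theorem SharpCommute.esum {φ ψ χ : Set (A × A)} (hχ : IsEndogeny χ)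
    (h1 : SharpCommute φ χ) (h2 : SharpCommute ψ χ) : SharpCommute (esum φ ψ) χ := by
  rw [sharpCommute_iff] at *
  rintro a b x c y hab ⟨x₁, x₂, hx₁, hx₂, hx⟩ ⟨c₁, c₂, hc₁, hc₂, hc⟩ hcy
  dsimp only at hx hc hx₁ hx₂ hc₁ hc₂
  subst hx hc
  obtain ⟨y₁, hy₁⟩ := hχ.2.1 c₁
  have hy₂ : (c₂, y - y₁) ∈ χ := by simpa using hχ.1.sub_mem_s7 hcy hy₁
  obtain ⟨k₁, l₁, hk₁, hl₁, e₁⟩ := h1 _ _ _ _ _ hab hx₁ hc₁ hy₁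
  obtain ⟨k₂, l₂, hk₂, hl₂, e₂⟩ := h2 _ _ _ _ _ hab hx₂ hc₂ hy₂
  refine ⟨k₁ + k₂, l₁ + l₂, ⟨k₁, k₂, hk₁, hk₂, rfl⟩, by simpa using hχ.1.add_mem hl₁ hl₂, ?_⟩
  rw [add_add_add_comm, e₁, e₂]
  abel

theorem SharpCommute.eneg {φ χ : Set (A × A)} (hχ : IsSubgroupRel χ)
    (h : SharpCommute φ χ) : SharpCommute (eneg φ) χ := by
  rw [sharpCommute_iff] at *
  intro a b x c y hab hbx hac hcy
  obtain ⟨k, l, hk, hl, e⟩ := h _ _ _ _ _ hab hbx hac (hχ.neg_mem hcy)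
  refine ⟨-k, -l, by simpa [_root_.eneg] using hk, by simpa using hχ.neg_mem hl, ?_⟩
  rw [← neg_add, e]
  abel

theorem SharpCommute.ecomp {φ ψ χ : Set (A × A)} (hφ : IsEndogeny φ) (hχ : IsEndogeny χ)
    (h1 : SharpCommute φ χ) (h2 : SharpCommute ψ χ) : SharpCommute (ecomp φ ψ) χ := by
  rw [sharpCommute_iff] at *
  rintro a b x e y hab ⟨d, hbd, hdx⟩ ⟨c, hac, hce⟩ hey
  dsimp only at hbd hdx hac hce
  obtain ⟨f, hcf⟩ := hχ.2.1 c
  obtain ⟨k, l, hk, hl, hkl⟩ := h2 _ _ _ _ _ hab hbd hac hcf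
  obtain ⟨k', hk'⟩ := hφ.2.1 k
  have hcl : (c, d - k) ∈ χ := by
    have hd : d - k = f + l := by rw [sub_eq_iff_eq_add, add_assoc, add_comm l, hkl]; abel
    simpa [hd] using hχ.1.add_mem hcf hl
  obtain ⟨m, n, hm, hn, hmn⟩ := h1 _ _ _ _ _ hcl (hφ.1.sub_mem_s7 hdx hk') hce hey
  refine ⟨k' + m, n, ⟨k, hk, by simpa using hφ.1.add_mem hk' hm⟩, hn, ?_⟩
  rw [add_assoc, hmn]
  abel

theorem sharp_centralizer_closed (φ ψ χ : Set (A × A))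
    (hφ : IsEndogeny φ) (hψ : IsEndogeny ψ) (hχ : IsEndogeny χ)
    (h1 : SharpCommute φ χ) (h2 : SharpCommute ψ χ) :
    SharpCommute (esum φ ψ) χ ∧ SharpCommute (eneg φ) χ ∧ SharpCommute (ecomp φ ψ) χ :=
  ⟨h1.esum hχ h2, h1.eneg hχ.1, h1.ecomp hφ hχ h2⟩
end

section
/- Let A be an abelian group, φ an endogeny of A, and B ≤ A a weakly φ-invariant subgroup. Then the restriction-corestriction φ_B := φ ∩ (B × B) is an endogeny of B: it is a total additive subrelation of B × B with finite katakernel kat(φ) ∩ B. -/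
open Pointwise

variable {A : Type*} [AddCommGroup A]

theorem restriction_isEndogeny (φ : Set (A × A)) (hφ : IsEndogeny φ)
    (B : AddSubgroup A) (hB : img φ (B : Set A) ⊆ (B : Set A) + kat φ) :
    IsEndogeny {p : B × B | ((p.1 : A), (p.2 : A)) ∈ φ} ∧
      Subtype.val '' kat {p : B × B | ((p.1 : A), (p.2 : A)) ∈ φ} = kat φ ∩ (B : Set A) := by
  obtain ⟨⟨h0, hadd, hneg⟩, htot, hfin⟩ := hφ
  have hkat : Subtype.val '' kat {p : B × B | ((p.1 : A), (p.2 : A)) ∈ φ} =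
      kat φ ∩ (B : Set A) := by
    ext b
    constructor
    · rintro ⟨c, hc, rfl⟩
      exact ⟨hc, c.2⟩
    · rintro ⟨hb, hbB⟩
      exact ⟨⟨b, hbB⟩, hb, rfl⟩
  refine ⟨⟨⟨h0, fun x hx y hy => hadd _ hx _ hy, fun x hx => hneg _ hx⟩, ?_, ?_⟩, hkat⟩
  · intro a
    obtain ⟨b, hb⟩ := htot a
    obtain ⟨c, hc, k, hk, rfl⟩ := Set.mem_add.mp (hB ⟨a, a.2, hb⟩)
    refine ⟨⟨c, hc⟩, ?_⟩
    simpa using hadd _ hb _ (hneg _ hk)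
  · refine Set.Finite.of_finite_image ?_ Subtype.val_injective.injOn
    rw [hkat]
    exact hfin.inter_of_left _
end

section
/- Let A be an abelian group and Γ, Δ two sets of endogenies of A, each closed under sum and composition, such that every γ ∈ Γ sharply commutes with every δ ∈ Δ. Then the global katakernel Kat(Γ), the subgroup generated by ⋃_{γ∈Γ} kat(γ), is Γ-invariant (γ[Kat(Γ)] ⊆ Kat(Γ) for every γ ∈ Γ) and weakly Δ-invariant (δ[Kat(Γ)] ⊆ Kat(Γ) + kat(δ) for every δ ∈ Δ). -/
open Pointwise

variable {A : Type*} [AddCommGroup A]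

/-- The global katakernel `Kat(Γ)`: the subgroup generated by all katakernels of elements of `Γ`. -/
def KatG (Γ : Set (Set (A × A))) : AddSubgroup A :=
  AddSubgroup.closure (⋃ γ ∈ Γ, kat γ)

/-- The katakernel of a subgroup relation, as an additive subgroup. -/
def IsSubgroupRel.katSubgroup {φ : Set (A × A)} (hφ : IsSubgroupRel φ) : AddSubgroup A where
  carrier := kat φ
  zero_mem' := hφ.1
  add_mem' {a b} ha hb := by simpa [kat] using hφ.2.1 _ ha _ hb
  neg_mem' {a} ha := by simpa [kat] using hφ.2.2 _ ha

/-- The image of the subgroup generated by `S` lies in any subgroup containing both the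
katakernel and the image of `S`. -/
theorem img_closure_subset {φ : Set (A × A)} (hφ : IsSubgroupRel φ)
    (htot : ∀ a : A, ∃ b, (a, b) ∈ φ) {S : Set A} {H : AddSubgroup A}
    (hkat : kat φ ⊆ (H : Set A)) (hS : img φ S ⊆ (H : Set A)) :
    img φ (AddSubgroup.closure S : Set A) ⊆ (H : Set A) := by
  rintro b ⟨a, ha, hab⟩
  rw [SetLike.mem_coe] at ha
  induction ha using AddSubgroup.closure_induction generalizing b with
  | mem x hx => exact hS ⟨x, hx, hab⟩
  | zero => exact hkat hab
  | add x y hx hy ihx ihy =>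
    obtain ⟨c, hc⟩ := htot x
    have hy' : (y, b - c) ∈ φ := by
      simpa [sub_eq_add_neg] using hφ.2.1 _ hab _ (hφ.2.2 _ hc)
    simpa using H.add_mem (ihx hc) (ihy hy')
  | neg x hx ih =>
    exact H.neg_mem_iff.mp (ih (by simpa using hφ.2.2 _ hab))

theorem kat_subset_katG {Γ : Set (Set (A × A))} {γ : Set (A × A)} (hγ : γ ∈ Γ) :
    kat γ ⊆ (KatG Γ : Set A) :=
  (Set.subset_biUnion_of_mem (u := kat) hγ).trans AddSubgroup.subset_closure

/-- If `γ` and `δ` sharply commute, then `δ` maps `kat γ` into `-(kat γ + kat δ)`. -/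
theorem SharpCommute.neg_mem_of_mem_img_kat {γ δ : Set (A × A)} (h : SharpCommute γ δ)
    (hγ : IsSubgroupRel γ) (hδ : IsSubgroupRel δ) {b : A} (hb : b ∈ img δ (kat γ)) :
    -b ∈ kat γ + kat δ := by
  obtain ⟨a, ha, hab⟩ := hb
  exact h ⟨0, Set.mem_univ _, 0, -b, ⟨0, hδ.1, hγ.1⟩, ⟨a, ha, by simpa using hab⟩, by simp⟩

theorem global_katakernel_invariant (Γ Δ : Set (Set (A × A)))
    (hΓ : ∀ γ ∈ Γ, IsEndogeny γ) (hΔ : ∀ δ ∈ Δ, IsEndogeny δ)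
    (hΓc : ∀ γ ∈ Γ, ∀ γ' ∈ Γ, esum γ γ' ∈ Γ ∧ ecomp γ γ' ∈ Γ)
    (hΔc : ∀ δ ∈ Δ, ∀ δ' ∈ Δ, esum δ δ' ∈ Δ ∧ ecomp δ δ' ∈ Δ)
    (hc : ∀ γ ∈ Γ, ∀ δ ∈ Δ, SharpCommute γ δ) :
    (∀ γ ∈ Γ, img γ (KatG Γ : Set A) ⊆ (KatG Γ : Set A)) ∧
    (∀ δ ∈ Δ, img δ (KatG Γ : Set A) ⊆ (KatG Γ : Set A) + kat δ) := by
  refine ⟨fun γ hγ => ?_, fun δ hδ => ?_⟩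
  · refine img_closure_subset (hΓ γ hγ).1 (hΓ γ hγ).2.1 (kat_subset_katG hγ) ?_
    rintro b ⟨a, ha, hab⟩
    obtain ⟨γ', hγ', ha'⟩ := Set.mem_iUnion₂.mp ha
    exact kat_subset_katG (hΓc γ hγ γ' hγ').2 ⟨a, ha', hab⟩
  · have hrel := (hΔ δ hδ).1
    have hsup : (KatG Γ : Set A) + kat δ = (KatG Γ ⊔ hrel.katSubgroup : AddSubgroup A) :=
      (AddSubgroup.add_normal (KatG Γ) hrel.katSubgroup).symm
    rw [hsup]
    refine img_closure_subset hrel (hΔ δ hδ).2.1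
      (le_sup_right : hrel.katSubgroup ≤ KatG Γ ⊔ hrel.katSubgroup) ?_
    rintro b ⟨a, ha, hab⟩
    obtain ⟨γ, hγ, ha'⟩ := Set.mem_iUnion₂.mp ha
    have hb := (hc γ hγ δ hδ).neg_mem_of_mem_img_kat (hΓ γ hγ).1 hrel ⟨a, ha', hab⟩
    refine (KatG Γ ⊔ hrel.katSubgroup).neg_mem_iff.mp ?_
    rw [← SetLike.mem_coe, ← hsup]
    exact Set.add_subset_add_right (kat_subset_katG hγ) hb
end

section
/- Let A be an abelian group, Γ a set of endogenies of A, and B a finite weakly Γ-invariant subgroup of A. Then the constant endogeny δ_B := A × B (i.e. {(a,b) : a ∈ A, b ∈ B}) is an endogeny of A with katakernel B that sharply commutes with every γ ∈ Γ. Consequently, if Δ is the set of all endogenies sharply commuting with every element of Γ, then B ⊆ Kat(Δ). -/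
open Pointwise

variable {A : Type*} [AddCommGroup A]

/-- The constant endogeny `A × B` of a finite subgroup `B` is an endogeny. -/
theorem isEndogeny_const (B : AddSubgroup A) (hfin : (B : Set A).Finite) :
    IsEndogeny {p : A × A | p.2 ∈ B} :=
  ⟨⟨B.zero_mem, fun _ hx _ hy => B.add_mem hx hy, fun _ hx => B.neg_mem hx⟩,
    fun _ => ⟨0, B.zero_mem⟩, hfin⟩

/-- The constant endogeny `A × B` sharply commutes with `γ` when `γ[B] ⊆ B + kat γ`. -/
theorem sharpCommute_const {γ : Set (A × A)} (hγ : IsSubgroupRel γ) (B : AddSubgroup A)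
    (hinv : img γ (B : Set A) ⊆ (B : Set A) + kat γ) :
    SharpCommute {p : A × A | p.2 ∈ B} γ := by
  rintro c ⟨a, -, c₁, c₂, ⟨_, -, hc₁⟩, ⟨b, hb, hbc⟩, hc⟩
  obtain ⟨e, he, k, hk, hek⟩ := Set.mem_add.mp (hinv ⟨b, hb, hbc⟩)
  refine Set.mem_add.mpr ⟨c₁ - e, B.sub_mem hc₁ he, -k, ?_, ?_⟩
  · simpa [kat] using hγ.2.2 _ hk
  · have hc₂ : c₂ = -(e + k) := by rw [hek, neg_neg]
    change c = c₁ + c₂ at hc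
    rw [hc, hc₂]
    abel

theorem constant_endogeny_sharpCommutes (Γ : Set (Set (A × A)))
    (hΓ : ∀ γ ∈ Γ, IsEndogeny γ) (B : AddSubgroup A)
    (hfin : (B : Set A).Finite)
    (hinv : ∀ γ ∈ Γ, img γ (B : Set A) ⊆ (B : Set A) + kat γ) :
    IsEndogeny {p : A × A | p.2 ∈ B} ∧
    kat {p : A × A | p.2 ∈ B} = (B : Set A) ∧
    (∀ γ ∈ Γ, SharpCommute {p : A × A | p.2 ∈ B} γ) ∧
    (B : Set A) ⊆
      (KatG {δ : Set (A × A) | IsEndogeny δ ∧ ∀ γ ∈ Γ, SharpCommute δ γ} : Set A) := by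
  have hδ := isEndogeny_const B hfin
  have hcomm : ∀ γ ∈ Γ, SharpCommute {p : A × A | p.2 ∈ B} γ :=
    fun γ hγ => sharpCommute_const (hΓ γ hγ).1 B (hinv γ hγ)
  exact ⟨hδ, rfl, hcomm, fun b hb =>
    AddSubgroup.subset_closure (Set.mem_biUnion ⟨hδ, hcomm⟩ hb)⟩
end

section
/- Let A be an abelian group, φ a quasi-endomorphism of A, and B ≤ A a subgroup of finite index in A. Then the preimage φ⁻¹[B] := {a ∈ A : ∃ b ∈ B, (a,b) ∈ φ} is a subgroup of finite index in A. -/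
open Pointwise

variable {A : Type*} [AddCommGroup A]

/-- The domain `Dom φ = {a : ∃ b, (a, b) ∈ φ}`. -/
def Dom (φ : Set (A × A)) : Set A := {a | ∃ b, (a, b) ∈ φ}

/-- A quasi-endomorphism of `A`: an additive subgroup of `A × A` whose domain has
finite index in `A` and whose katakernel is finite. -/
def IsQuasiEndo (φ : Set (A × A)) : Prop :=
  IsSubgroupRel φ ∧ (∃ F : Set A, F.Finite ∧ Set.univ ⊆ Dom φ + F) ∧ (kat φ).Finite

/-- The preimage `φ⁻¹[S]`. -/
def preimg (φ : Set (A × A)) (S : Set A) : Set A := {a | ∃ b ∈ S, (a, b) ∈ φ}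

/-- Subtracting two elements related to the same coset of `B` lands in the preimage of `B`. -/
theorem IsSubgroupRel.sub_mem_preimg {φ : Set (A × A)} (hφ : IsSubgroupRel φ)
    {B : AddSubgroup A} {a a' b b' : A} (h : (a, b) ∈ φ) (h' : (a', b') ∈ φ)
    (hb : b - b' ∈ B) : a - a' ∈ preimg φ (B : Set A) :=
  ⟨b - b', hb, by simpa [sub_eq_add_neg] using hφ.2.1 _ h _ (hφ.2.2 _ h')⟩

/-- Finitely many translates of the preimage of a finite index subgroup cover the domain. -/
theorem IsSubgroupRel.exists_finite_dom_subset {φ : Set (A × A)} (hφ : IsSubgroupRel φ)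
    (B : AddSubgroup A) [B.FiniteIndex] :
    ∃ R : Set A, R.Finite ∧ Dom φ ⊆ preimg φ (B : Set A) + R := by
  have hr : ∀ c : A ⧸ B, ∃ r : A, ∀ a b : A, (a, b) ∈ φ → (b : A ⧸ B) = c →
      a - r ∈ preimg φ (B : Set A) := by
    intro c
    by_cases hc : ∃ a b : A, (a, b) ∈ φ ∧ (b : A ⧸ B) = c
    · obtain ⟨r, s, hrs, rfl⟩ := hc
      exact ⟨r, fun a b hab h => hφ.sub_mem_preimg hab hrs (QuotientAddGroup.eq_iff_sub_mem.1 h)⟩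
    · exact ⟨0, fun a b hab h => (hc ⟨a, b, hab, h⟩).elim⟩
  choose r hr using hr
  refine ⟨Set.range r, Set.finite_range r, ?_⟩
  rintro a ⟨b, hab⟩
  exact ⟨a - r b, hr _ a b hab rfl, r b, ⟨_, rfl⟩, sub_add_cancel _ _⟩

theorem quasiEndo_preimage_finiteIndex (φ : Set (A × A)) (hφ : IsQuasiEndo φ)
    (B : AddSubgroup A) (hB : B.FiniteIndex) :
    (0 ∈ preimg φ (B : Set A) ∧
      (∀ x ∈ preimg φ (B : Set A), ∀ y ∈ preimg φ (B : Set A), x + y ∈ preimg φ (B : Set A)) ∧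
      ∀ x ∈ preimg φ (B : Set A), -x ∈ preimg φ (B : Set A)) ∧
    ∃ F : Set A, F.Finite ∧ Set.univ ⊆ preimg φ (B : Set A) + F := by
  obtain ⟨hsub, ⟨F, hF, hcov⟩, -⟩ := hφ
  obtain ⟨R, hR, hdom⟩ := hsub.exists_finite_dom_subset B
  refine ⟨⟨⟨0, B.zero_mem, hsub.1⟩, ?_, ?_⟩, R + F, hR.add hF, ?_⟩
  · rintro x ⟨b, hb, hx⟩ y ⟨c, hc, hy⟩
    exact ⟨b + c, B.add_mem hb hc, hsub.2.1 _ hx _ hy⟩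
  · rintro x ⟨b, hb, hx⟩
    exact ⟨-b, B.neg_mem hb, hsub.2.2 _ hx⟩
  · rw [← add_assoc]
    exact hcov.trans (Set.add_subset_add_right hdom)
end

section
/- Let A be an abelian group and γ, δ two flat-commuting quasi-endomorphisms of A. Then δ[kat(γ)] ⊆ kat(γ) + kat(δ) and γ[kat(δ)] ⊆ kat(γ) + kat(δ). -/
open Pointwise

variable {A : Type*} [AddCommGroup A]

/-- `γ` and `δ` flat commute. -/
def FlatCommute (γ δ : Set (A × A)) : Prop :=
  img γ (Dom δ ∩ Dom γ) ⊆ Dom δ ∧ img δ (Dom γ ∩ Dom δ) ⊆ Dom γ ∧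
    img (esum (ecomp γ δ) (eneg (ecomp δ γ))) (Dom γ ∩ Dom δ) ⊆ kat γ + kat δ

theorem flatCommute_img_kat (γ δ : Set (A × A))
    (hγ : IsQuasiEndo γ) (hδ : IsQuasiEndo δ) (h : FlatCommute γ δ) :
    img δ (kat γ) ⊆ kat γ + kat δ ∧ img γ (kat δ) ⊆ kat γ + kat δ := by
  obtain ⟨⟨hγ0, -, hγneg⟩, -⟩ := hγ
  obtain ⟨⟨hδ0, -, hδneg⟩, -⟩ := hδ
  have hdom : (0 : A) ∈ Dom γ ∩ Dom δ := ⟨⟨0, hγ0⟩, ⟨0, hδ0⟩⟩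
  constructor
  · rintro c ⟨b, hb, hbc⟩
    have hb' : ((0 : A), -b) ∈ γ := by simpa using hγneg _ hb
    exact h.2.2 ⟨0, hdom, 0, c, ⟨0, hδ0, hγ0⟩, ⟨-b, hb', hδneg _ hbc⟩, (zero_add c).symm⟩
  · rintro c ⟨b, hb, hbc⟩
    refine h.2.2 ⟨0, hdom, c, 0, ⟨b, hb, hbc⟩, ⟨0, hγ0, ?_⟩, (add_zero c).symm⟩
    change ((0 : A), -(0 : A)) ∈ δ
    rw [neg_zero]
    exact hδ0
end

section
/- Let A be an abelian group and Γ, Δ two sets of quasi-endomorphisms of A, each closed under sum and composition, such that every γ ∈ Γ flat commutes with every δ ∈ Δ. Then the global bikatakernel Kat(Γ,Δ), the subgroup of A generated by all katakernels kat(γ) for γ ∈ Γ together with all kat(δ) for δ ∈ Δ, is (Γ,Δ)-invariant: for every φ ∈ Γ ∪ Δ one has φ[Kat(Γ,Δ) ∩ Dom(φ)] ⊆ Kat(Γ,Δ). -/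
open Pointwise

variable {A : Type*} [AddCommGroup A]

/-- The global bikatakernel `Kat(Γ, Δ)`. -/
def KatGD (Γ Δ : Set (Set (A × A))) : AddSubgroup A :=
  AddSubgroup.closure ((⋃ γ ∈ Γ, kat γ) ∪ ⋃ δ ∈ Δ, kat δ)

lemma kat_subset_KatGD_left {Γ Δ : Set (Set (A × A))} {γ : Set (A × A)} (hγ : γ ∈ Γ) :
    kat γ ⊆ (KatGD Γ Δ : Set A) := fun _ hx =>
  AddSubgroup.subset_closure (Or.inl (Set.mem_biUnion hγ hx))

lemma kat_subset_KatGD_right {Γ Δ : Set (Set (A × A))} {δ : Set (A × A)} (hδ : δ ∈ Δ) :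
    kat δ ⊆ (KatGD Γ Δ : Set A) := fun _ hx =>
  AddSubgroup.subset_closure (Or.inr (Set.mem_biUnion hδ hx))

lemma KatGD_comm (Γ Δ : Set (Set (A × A))) : KatGD Γ Δ = KatGD Δ Γ := by
  rw [KatGD, KatGD, Set.union_comm]

/-- If `γ` and `δ` flat commute, every element of `kat δ` has an image under `γ` in
`kat γ + kat δ`. -/
lemma FlatCommute.exists_image_of_mem_kat_right {γ δ : Set (A × A)} (h : FlatCommute γ δ)
    (hγ : IsSubgroupRel γ) (hδ : IsSubgroupRel δ) {x : A} (hx : x ∈ kat δ) :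
    ∃ y ∈ kat γ + kat δ, (x, y) ∈ γ := by
  have h0 : (0 : A) ∈ Dom γ ∩ Dom δ := ⟨⟨0, hγ.1⟩, ⟨0, hδ.1⟩⟩
  obtain ⟨y, hy⟩ := h.2.1 ⟨0, h0, hx⟩
  refine ⟨y, h.2.2 ⟨0, h0, y, 0, ⟨x, hx, hy⟩, ⟨0, hγ.1, ?_⟩, (add_zero y).symm⟩, hy⟩
  simpa using show ((0 : A), (0 : A)) ∈ δ from hδ.1

/-- If `γ` and `δ` flat commute, every element of `kat γ` has an image under `δ` whose
negative lies in `kat γ + kat δ`. -/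
lemma FlatCommute.exists_image_of_mem_kat_left {γ δ : Set (A × A)} (h : FlatCommute γ δ)
    (hγ : IsSubgroupRel γ) (hδ : IsSubgroupRel δ) {x : A} (hx : x ∈ kat γ) :
    ∃ y, -y ∈ kat γ + kat δ ∧ (x, y) ∈ δ := by
  have h0 : (0 : A) ∈ Dom γ ∩ Dom δ := ⟨⟨0, hγ.1⟩, ⟨0, hδ.1⟩⟩
  obtain ⟨y, hy⟩ := h.1 ⟨0, h0.symm, hx⟩
  refine ⟨y, h.2.2 ⟨0, h0, 0, -y, ⟨0, hδ.1, hγ.1⟩, ⟨x, hx, ?_⟩, (zero_add _).symm⟩, hy⟩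
  simpa using hy

/-- The katakernels of a nonempty family of subgroup relations closed under sum are directed,
so the subgroup they generate is their union. -/
lemma exists_mem_kat_of_mem_closure {Γ : Set (Set (A × A))} (hne : Γ.Nonempty)
    (hΓ : ∀ γ ∈ Γ, IsSubgroupRel γ) (hsum : ∀ γ ∈ Γ, ∀ γ' ∈ Γ, esum γ γ' ∈ Γ)
    {x : A} (hx : x ∈ AddSubgroup.closure (⋃ γ ∈ Γ, kat γ)) : ∃ γ ∈ Γ, x ∈ kat γ := by
  induction hx using AddSubgroup.closure_induction with
  | mem x hx => simpa using hx
  | zero =>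
    obtain ⟨γ, hγ⟩ := hne
    exact ⟨γ, hγ, (hΓ γ hγ).1⟩
  | add x y _ _ hx hy =>
    obtain ⟨γ, hγ, hx⟩ := hx
    obtain ⟨γ', hγ', hy⟩ := hy
    exact ⟨_, hsum γ hγ γ' hγ', x, y, hx, hy, rfl⟩
  | neg x _ hx =>
    obtain ⟨γ, hγ, hx⟩ := hx
    exact ⟨γ, hγ, by simpa [kat] using (hΓ γ hγ).2.2 _ hx⟩

/-- `Kat(Γ, Δ)` is `Γ`-invariant as soon as every element of a katakernel of `Δ` has an image
in `Kat(Γ, Δ)` under every element of `Γ`. -/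
lemma img_KatGD_subset {Γ Δ : Set (Set (A × A))} (hΓ : ∀ γ ∈ Γ, IsSubgroupRel γ)
    (hΓc : ∀ γ ∈ Γ, ∀ γ' ∈ Γ, esum γ γ' ∈ Γ ∧ ecomp γ γ' ∈ Γ)
    (h : ∀ γ ∈ Γ, ∀ δ ∈ Δ, ∀ x ∈ kat δ, ∃ y ∈ KatGD Γ Δ, (x, y) ∈ γ)
    {φ : Set (A × A)} (hφ : φ ∈ Γ) :
    img φ ((KatGD Γ Δ : Set A) ∩ Dom φ) ⊆ (KatGD Γ Δ : Set A) := by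
  have hS := hΓ φ hφ
  rintro z ⟨x, ⟨hx, -⟩, hxz⟩
  rw [SetLike.mem_coe, KatGD, AddSubgroup.closure_union, AddSubgroup.mem_sup] at hx
  obtain ⟨k, hk, l, hl, rfl⟩ := hx
  obtain ⟨γ, hγ, hk⟩ :=
    exists_mem_kat_of_mem_closure ⟨φ, hφ⟩ hΓ (fun γ hγ γ' hγ' => (hΓc γ hγ γ' hγ').1) hk
  have hl : ∃ y ∈ KatGD Γ Δ, (l, y) ∈ φ := by
    clear hxz
    induction hl using AddSubgroup.closure_induction with
    | mem l hl =>
      obtain ⟨δ, hδ, hl⟩ := Set.mem_iUnion₂.1 hl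
      exact h φ hφ δ hδ l hl
    | zero => exact ⟨0, zero_mem _, hS.1⟩
    | add l m _ _ hl hm =>
      obtain ⟨y, hy, hly⟩ := hl
      obtain ⟨w, hw, hmw⟩ := hm
      exact ⟨y + w, add_mem hy hw, hS.2.1 _ hly _ hmw⟩
    | neg l _ hl =>
      obtain ⟨y, hy, hly⟩ := hl
      exact ⟨-y, neg_mem hy, hS.2.2 _ hly⟩
  obtain ⟨y, hy, hly⟩ := hl
  have hkz : (k, z - y) ∈ φ := by
    simpa [sub_eq_add_neg] using hS.2.1 _ hxz _ (hS.2.2 _ hly)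
  have hzy : z - y ∈ KatGD Γ Δ :=
    kat_subset_KatGD_left (hΓc φ hφ γ hγ).2 ⟨k, hk, hkz⟩
  simpa using add_mem hzy hy

theorem bikatakernel_invariant (Γ Δ : Set (Set (A × A)))
    (hΓ : ∀ γ ∈ Γ, IsQuasiEndo γ) (hΔ : ∀ δ ∈ Δ, IsQuasiEndo δ)
    (hΓc : ∀ γ ∈ Γ, ∀ γ' ∈ Γ, esum γ γ' ∈ Γ ∧ ecomp γ γ' ∈ Γ)
    (hΔc : ∀ δ ∈ Δ, ∀ δ' ∈ Δ, esum δ δ' ∈ Δ ∧ ecomp δ δ' ∈ Δ)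
    (hc : ∀ γ ∈ Γ, ∀ δ ∈ Δ, FlatCommute γ δ) :
    ∀ φ ∈ Γ ∪ Δ, img φ ((KatGD Γ Δ : Set A) ∩ Dom φ) ⊆ (KatGD Γ Δ : Set A) := by
  have hkat : ∀ γ ∈ Γ, ∀ δ ∈ Δ, kat γ + kat δ ⊆ (KatGD Γ Δ : Set A) := by
    rintro γ hγ δ hδ _ ⟨a, ha, b, hb, rfl⟩
    exact add_mem (kat_subset_KatGD_left hγ ha) (kat_subset_KatGD_right hδ hb)
  rintro φ (hφ | hφ)
  · refine img_KatGD_subset (fun γ hγ => (hΓ γ hγ).1) hΓc (fun γ hγ δ hδ x hx => ?_) hφ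
    obtain ⟨y, hy, hxy⟩ :=
      (hc γ hγ δ hδ).exists_image_of_mem_kat_right (hΓ γ hγ).1 (hΔ δ hδ).1 hx
    exact ⟨y, hkat γ hγ δ hδ hy, hxy⟩
  · rw [KatGD_comm Γ Δ] at hkat ⊢
    refine img_KatGD_subset (fun δ hδ => (hΔ δ hδ).1) hΔc (fun δ hδ γ hγ x hx => ?_) hφ
    obtain ⟨y, hy, hxy⟩ :=
      (hc γ hγ δ hδ).exists_image_of_mem_kat_left (hΓ γ hγ).1 (hΔ δ hδ).1 hx
    exact ⟨y, neg_mem_iff.1 (hkat γ hγ δ hδ hy), hxy⟩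
end
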